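/- Let G be a 2-step nilpotent subgroup of UT(n,ℚ) and let 𝒢_1,...,𝒢_M be finite subsets of G, with 𝒢_m = {A_{m1},...,A_{mK_m}}. Then the intersection of the generated sub-semigroups ⟨𝒢_1⟩ ∩ ⋯ ∩ ⟨𝒢_M⟩ is non-empty if and only if there exist non-zero vectors ℓ_m ∈ ℤ_{≥0}^{K_m} \ {0} and rational numbers c_{mij} (for 1 ≤ m ≤ M and i < j in supp(ℓ_m)) such that the M expressions Σ_{j=1}^{K_m} ℓ_{mj} log A_{mj} + Σ_{i<j, i,j ∈ supp(ℓ_m)} c_{mij} [log A_{mi}, log A_{mj}] (m = 1,...,M) are all equal. -/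

import Mathlib

/-- Upper unitriangular rational matrix: ones on the diagonal, zeros below. -/
def IsUnitriangular {n : ℕ} (A : Matrix (Fin n) (Fin n) ℚ) : Prop :=
  (∀ i, A i i = 1) ∧ ∀ i j : Fin n, j < i → A i j = 0

/-- Strictly upper triangular rational matrix: zeros on and below the diagonal. -/
def IsStrictUpper {n : ℕ} (X : Matrix (Fin n) (Fin n) ℚ) : Prop :=
  ∀ i j : Fin n, j ≤ i → X i j = 0

/-- Matrix logarithm on unitriangular matrices (a finite sum). -/
def mlog {n : ℕ} (A : Matrix (Fin n) (Fin n) ℚ) : Matrix (Fin n) (Fin n) ℚ :=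
  ∑ k ∈ Finset.Icc 1 n, ((-1 : ℚ) ^ (k - 1) / (k : ℚ)) • (A - 1) ^ k

/-- Matrix exponential on strictly upper triangular matrices (a finite sum). -/
def mexp {n : ℕ} (X : Matrix (Fin n) (Fin n) ℚ) : Matrix (Fin n) (Fin n) ℚ :=
  ∑ k ∈ Finset.range (n + 1), ((k.factorial : ℚ))⁻¹ • X ^ k

/-- Commutator bracket [X, Y] = XY − YX. -/
def mcomm {n : ℕ} (X Y : Matrix (Fin n) (Fin n) ℚ) : Matrix (Fin n) (Fin n) ℚ :=
  X * Y - Y * X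

section BCHPart
open Polynomial

/-- Truncated exponential. -/
noncomputable def exN {R : Type*} [Ring R] [Algebra ℚ R] (N : ℕ) (x : R) : R :=
  ∑ k ∈ Finset.range N, ((k.factorial : ℚ))⁻¹ • x ^ k

noncomputable def exP {R : Type*} [Ring R] [Algebra ℚ R] (N : ℕ) (x : R) : R[X] :=
  ∑ k ∈ Finset.range N, monomial k (((k.factorial : ℚ))⁻¹ • x ^ k)

noncomputable def exH {R : Type*} [Ring R] [Algebra ℚ R] (N : ℕ) (x : R) : R[X] :=
  ∑ k ∈ Finset.range N, monomial (2 * k) (((k.factorial : ℚ))⁻¹ • x ^ k)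

variable {R : Type*} [Ring R] [Algebra ℚ R]

theorem fact_aux (k : ℕ) : ((k + 1 : ℕ) : ℚ) * (((k + 1).factorial : ℕ) : ℚ)⁻¹
    = ((k.factorial : ℕ) : ℚ)⁻¹ := by
  rw [Nat.factorial_succ]
  have h1 : ((k : ℚ) + 1) ≠ 0 := by positivity
  have h2 : (k.factorial : ℚ) ≠ 0 := by positivity
  push_cast
  field_simp

theorem smul_fact_aux (k : ℕ) (y : R) : ((((k + 1).factorial : ℕ) : ℚ)⁻¹ • y) * ((k : R) + 1)
    = (((k.factorial : ℕ) : ℚ)⁻¹) • y := by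
  have : ((k : R) + 1) = ((k + 1 : ℕ) : ℚ) • (1 : R) := by
    rw [Nat.cast_smul_eq_nsmul, nsmul_eq_mul]; push_cast; simp
  rw [this, mul_smul_comm, mul_one, smul_smul, fact_aux]

theorem coeff_exP {N : ℕ} {x : R} (hx : x ^ N = 0) (k : ℕ) :
    (exP N x).coeff k = ((k.factorial : ℚ))⁻¹ • x ^ k := by
  simp only [exP, finsetSum_coeff, coeff_monomial, Finset.sum_ite_eq', Finset.mem_range]
  split_ifs with h
  · rfl
  · rw [pow_eq_zero_of_le (not_lt.mp h) hx, smul_zero]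

theorem derivative_exP {N : ℕ} {x : R} (hx : x ^ N = 0) :
    derivative (exP N x) = C x * exP N x := by
  ext k
  rw [coeff_derivative, coeff_C_mul, coeff_exP hx, coeff_exP hx, smul_fact_aux, mul_smul_comm,
    pow_succ']

theorem derivative_exH {N : ℕ} {x : R} (hx : x ^ N = 0) :
    derivative (exH N x) = X * C (x + x) * exH N x := by
  cases N with
  | zero => simp [exH]
  | succ N =>
    have e1 : derivative (exH (N + 1) x) =
        ∑ k ∈ Finset.range N, X * C (x + x) * monomial (2 * k) (((k.factorial : ℚ))⁻¹ • x ^ k) := by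
      rw [exH, Finset.sum_range_succ', derivative_add, derivative_sum]
      have : derivative (monomial (2 * 0) ((((0 : ℕ).factorial : ℚ))⁻¹ • x ^ 0)) = 0 := by simp
      rw [this, add_zero]
      refine Finset.sum_congr rfl fun k _ => ?_
      rw [derivative_monomial, mul_assoc, C_mul_monomial, X_mul_monomial]
      have h2 : 2 * (k + 1) - 1 = 2 * k + 1 := by omega
      rw [h2]
      congr 1
      have h3 : (((2 * (k + 1) : ℕ)) : R) = ((k : R) + 1) + ((k : R) + 1) := by
        push_cast; rw [two_mul]
      rw [h3, mul_add, smul_fact_aux, add_mul, mul_smul_comm, pow_succ']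
    rw [e1, exH, Finset.mul_sum, Finset.sum_range_succ]
    have h4 : (x + x) * x ^ N = 0 := by rw [add_mul, ← pow_succ', hx, add_zero]
    rw [mul_assoc X (C (x + x)) (monomial (2 * N) _), C_mul_monomial, mul_smul_comm, h4]
    simp

theorem ode_unique (a b : R) (P : R[X]) (h : derivative P = (C a + X * C b) * P)
    (h0 : P.coeff 0 = 0) : P = 0 := by
  have key : ∀ k, P.coeff k = 0 ∧ P.coeff (k + 1) = 0 := by
    have step : ∀ k, P.coeff (k + 1) * ((k : R) + 1) = (derivative P).coeff k := by
      intro k; rw [coeff_derivative]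
    have canc : ∀ (k : ℕ) (y : R), y * ((k : R) + 1) = 0 → y = 0 := by
      intro k y hy
      have : ((k : R) + 1) = ((k + 1 : ℕ) : ℚ) • (1 : R) := by
        rw [Nat.cast_smul_eq_nsmul, nsmul_eq_mul]; push_cast; simp
      rw [this, mul_smul_comm, mul_one] at hy
      have h3 : (((k + 1 : ℕ) : ℚ)) ≠ 0 := by positivity
      have := congrArg (fun z => ((((k + 1 : ℕ) : ℚ))⁻¹) • z) hy
      simp only [smul_smul, inv_mul_cancel₀ h3, one_smul, smul_zero] at this
      exact this
    intro k
    induction k with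
    | zero =>
      refine ⟨h0, canc 0 _ ?_⟩
      rw [step, h, add_mul, mul_assoc]
      simp [h0]
    | succ k ih =>
      refine ⟨ih.2, canc (k + 1) _ ?_⟩
      rw [step, h, add_mul, mul_assoc]
      simp [ih.1, ih.2]
  ext k
  simpa using (key k).1

theorem exP_mul_C {N : ℕ} {x y : R} (hx : x ^ N = 0) (hc : Commute (x * y - y * x) x) :
    exP N x * C y = (C y + X * C (x * y - y * x)) * exP N x := by
  rw [← sub_eq_zero]
  apply ode_unique x 0
  · simp only [derivative_sub, derivative_mul, derivative_add, derivative_exP hx, derivative_C,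
      derivative_X, map_zero, mul_zero, add_zero, zero_add, one_mul, zero_mul]
    have hc' : C (x * y - y * x) * C x = C x * C (x * y - y * x) := by
      rw [← C_mul, ← C_mul, hc.eq]
    have h2 : C (x * y - y * x) = C x * C y - C y * C x := by simp
    have hX : (X : R[X]) * C x = C x * X := X_mul_C x
    generalize C (x * y - y * x) = c at *
    have e1 : (C y + X * c) * (C x * exP N x) = (C x * C y - c + C x * X * c) * exP N x := by
      rw [← mul_assoc, add_mul, mul_assoc X, hc', ← mul_assoc X, hX, h2]; noncomm_ring
    rw [e1]; noncomm_ring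
  · simp [mul_coeff_zero, coeff_exP hx]

/-- evaluation at one as a ring hom -/
noncomputable def ev1 : R[X] →+* R := eval₂RingHom' (RingHom.id R) 1 (fun a => Commute.one_right a)

theorem ev1_exP (N : ℕ) (x : R) : ev1 (exP N x) = exN N x := by
  simp [ev1, exP, exN, eval₂RingHom', eval₂_finsetSum, eval₂_monomial]

theorem ev1_exH (N : ℕ) (x : R) : ev1 (exH N x) = exN N x := by
  simp [ev1, exH, exN, eval₂RingHom', eval₂_finsetSum, eval₂_monomial]

theorem exN_eq {N : ℕ} {x : R} (hx : x ^ N = 0) : exN N x = IsNilpotent.exp x :=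
  (IsNilpotent.exp_eq_sum hx).symm

theorem exP_comm_C {N : ℕ} {x c : R} (hx : x ^ N = 0) (hc : Commute c x) :
    exP N x * C c = C c * exP N x := by
  have h : x * c - c * x = 0 := by rw [hc.eq, sub_self]
  have := exP_mul_C (y := c) hx (by rw [h]; exact Commute.zero_left x)
  rw [this, h]; simp

theorem bch_aux {N : ℕ} {x y c : R} (hc : c = x * y - y * x) (hcx : Commute c x)
    (hcy : Commute c y)
    (hx : x ^ N = 0) (hy : y ^ N = 0) (hxy : (x + y) ^ N = 0) (hd : ((1 / 2 : ℚ) • c) ^ N = 0)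
    (hall : (x + y + (1 / 2 : ℚ) • c) ^ N = 0) :
    exN N x * exN N y = exN N (x + y + (1 / 2 : ℚ) • c) := by
  have h0N : ∀ z : R, (exP N z).coeff 0 = (exH N z).coeff 0 := by
    intro z
    simp [exP, exH, finsetSum_coeff, coeff_monomial]
  have hdd : (1 / 2 : ℚ) • c + (1 / 2 : ℚ) • c = c := by
    rw [← add_smul]; norm_num
  have main : exP N x * exP N y = exP N (x + y) * exH N ((1 / 2 : ℚ) • c) := by
    rw [← sub_eq_zero]
    apply ode_unique (x + y) c
    · rw [derivative_sub, derivative_mul, derivative_mul, derivative_exP hx, derivative_exP hy,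
        derivative_exP hxy, derivative_exH hd, hdd]
      have e1 : exP N x * (C y * exP N y) = (C y + X * C c) * (exP N x * exP N y) := by
        rw [← mul_assoc, exP_mul_C hx (by rw [← hc]; exact hcx), ← hc]; noncomm_ring
      have e2 : exP N (x + y) * (X * C c * exH N ((1 / 2 : ℚ) • c))
          = X * C c * (exP N (x + y) * exH N ((1 / 2 : ℚ) • c)) := by
        have := exP_comm_C (c := c) hxy (hcx.add_right hcy)
        rw [← mul_assoc, ← mul_assoc, ← X_mul, mul_assoc X, this]; noncomm_ring
      rw [e1, e2, C_add]; noncomm_ring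
    · rw [coeff_sub, mul_coeff_zero, mul_coeff_zero, ← h0N, coeff_exP hx, coeff_exP hy,
        coeff_exP hxy, coeff_exP hd]
      simp
  have := congrArg ev1 main
  rw [map_mul, map_mul, ev1_exP, ev1_exP, ev1_exP, ev1_exH] at this
  rw [this, exN_eq hxy, exN_eq hd, exN_eq hall, IsNilpotent.exp_add_of_commute _ ⟨N, hxy⟩ ⟨N, hd⟩]
  exact (((hcx.add_right hcy).symm).smul_right _)

/-! exp after log -/

noncomputable def lgPoly (n : ℕ) : ℚ[X] :=
  ∑ k ∈ Finset.Icc 1 n, monomial k ((-1 : ℚ) ^ (k - 1) / (k : ℚ))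

theorem X_dvd_lgPoly (n : ℕ) : (X : ℚ[X]) ∣ lgPoly n := by
  apply Finset.dvd_sum
  intro k hk
  rw [Finset.mem_Icc] at hk
  rw [X_dvd_iff, coeff_monomial, if_neg (by omega)]

theorem deriv_lgPoly (n : ℕ) : (1 + X) * derivative (lgPoly n) = 1 - (-X) ^ n := by
  have : derivative (lgPoly n) = ∑ k ∈ Finset.range n, (-X : ℚ[X]) ^ k := by
    rw [lgPoly, derivative_sum, ← Finset.sum_bij (s := Finset.range n) (fun k _ => k + 1)]
    · intro k hk; simp at hk ⊢; omega
    · intro a _ b _ h; simpa using h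
    · intro b hb; simp at hb; exact ⟨b - 1, by simp; omega, by omega⟩
    · intro k hk
      rw [derivative_monomial]
      have : ((-1 : ℚ) ^ (k + 1 - 1) / ((k + 1 : ℕ) : ℚ)) * ((k + 1 : ℕ) : ℚ) = (-1) ^ k := by
        have h3 : (((k + 1 : ℕ) : ℚ)) ≠ 0 := by positivity
        rw [div_mul_cancel₀ _ h3]; simp
      rw [this, neg_pow, ← C_mul_X_pow_eq_monomial]; simp
  rw [this]
  have := mul_neg_geom_sum (-X : ℚ[X]) n
  rw [← this]; ring

theorem exp_lg_aux (n : ℕ) : (X : ℚ[X]) ^ (n + 1) ∣ ((exP (n + 1) (1 : ℚ)).comp (lgPoly n)) - (1 + X) := by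
  set e := exP (n + 1) (1 : ℚ) with he
  set g := e.comp (lgPoly n) with hg
  have hde : derivative e = e - monomial n ((n.factorial : ℚ)⁻¹) := by
    have h1 : derivative e = exP n (1 : ℚ) := by
      ext k
      rw [coeff_derivative, he]
      simp only [exP, finsetSum_coeff, coeff_monomial, Finset.sum_ite_eq', Finset.mem_range]
      by_cases h : k < n
      · have := smul_fact_aux (R := ℚ) k 1
        simp [h] at this ⊢
        exact this
      · simp [h]
    rw [h1, he, exP, exP, Finset.sum_range_succ]; simp
  have hdg : (1 + X) * derivative g = (1 - (-X) ^ n) * (g - C ((n.factorial : ℚ)⁻¹) * lgPoly n ^ n) := by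
    rw [hg, derivative_comp, ← mul_assoc, deriv_lgPoly, hde]
    congr 1
    rw [sub_comp, monomial_comp]
  have hdv : (X : ℚ[X]) ^ n ∣ (1 + X) * derivative g - g := by
    rw [hdg]
    have h1 : (X : ℚ[X]) ^ n ∣ (-X) ^ n := pow_dvd_pow_of_dvd (by simp) n
    have h2 : (X : ℚ[X]) ^ n ∣ lgPoly n ^ n := pow_dvd_pow_of_dvd (X_dvd_lgPoly n) n
    have : (1 - (-X) ^ n) * (g - C ((n.factorial : ℚ)⁻¹) * lgPoly n ^ n) - g
      = (-X) ^ n * (- (g - C ((n.factorial : ℚ)⁻¹) * lgPoly n ^ n)) - lgPoly n ^ n * C ((n.factorial : ℚ)⁻¹) := by ring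
    rw [this]
    exact dvd_sub (h1.mul_right _) (h2.mul_right _)
  have hco : ∀ k < n, g.coeff (k + 1) * (k + 1) + k * g.coeff k - g.coeff k = 0 := by
    intro k hk
    have := (X_pow_dvd_iff.mp hdv) k hk
    rw [coeff_sub, add_mul, one_mul, coeff_add, coeff_derivative] at this
    rw [← this]
    congr 2
    cases k with
    | zero => simp
    | succ k => rw [coeff_X_mul, coeff_derivative]; push_cast; ring
  have h0 : g.coeff 0 = 1 := by
    rw [coeff_zero_eq_eval_zero, hg, eval_comp]
    have : eval 0 (lgPoly n) = 0 := by
      rw [← coeff_zero_eq_eval_zero]; exact X_dvd_iff.mp (X_dvd_lgPoly n)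
    rw [this, ← coeff_zero_eq_eval_zero, he]
    simp [exP, finsetSum_coeff, coeff_monomial]
  have hge : ∀ k, k + 1 < n → g.coeff (k + 2) = 0 := by
    intro k
    induction k with
    | zero =>
      intro h
      have := hco 1 h
      norm_num at this
      exact this
    | succ k ih =>
      intro h
      have h1 := hco (k + 2) h
      rw [ih (by omega)] at h1
      simp only [mul_zero, add_zero, sub_zero] at h1
      have : (((k + 2 : ℕ) : ℚ) + 1) ≠ 0 := by positivity
      exact (mul_eq_zero.mp h1).resolve_right this
  rw [X_pow_dvd_iff]
  intro k hk
  match k with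
  | 0 => simp [h0]
  | 1 =>
    have := hco 0 (by omega)
    simp [h0] at this
    simp [coeff_one]
    linarith
  | k + 2 => simp [hge k (by omega), coeff_one, coeff_X]

end BCHPart
section MatPart
open Polynomial

theorem exp_eq_one_imp {R : Type*} [Ring R] [Algebra ℚ R] {z : R} {N : ℕ} (hz : z ^ N = 0)
    (h : IsNilpotent.exp z = 1) : z = 0 := by
  have hz2 : z ^ (N + 2) = 0 := by rw [pow_add, hz, zero_mul]
  rw [IsNilpotent.exp_eq_sum hz2, Finset.sum_range_succ', Finset.sum_range_succ'] at h
  set q : R := ∑ k ∈ Finset.range N, (((k + 1 + 1).factorial : ℚ))⁻¹ • z ^ k with hq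
  have hs : ∑ k ∈ Finset.range N, (((k + 1 + 1).factorial : ℚ))⁻¹ • z ^ (k + 1 + 1) = z * (z * q) := by
    rw [hq, Finset.mul_sum, Finset.mul_sum]
    refine Finset.sum_congr rfl fun k _ => ?_
    rw [mul_smul_comm, mul_smul_comm, ← pow_succ', ← pow_succ']
  rw [hs] at h
  simp at h
  have hcq : Commute z q := by
    apply Commute.sum_right
    intro k _
    exact ((Commute.refl z).pow_right k).smul_right _
  have hr : z = z * (-(z * q)) := by
    rw [mul_neg, eq_neg_iff_add_eq_zero, add_comm]; exact h
  have hk : ∀ k : ℕ, z = z * (-(z * q)) ^ k := by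
    intro k
    induction k with
    | zero => simp
    | succ k ih => rw [pow_succ', ← mul_assoc, ← hr]; exact ih
  have := hk N
  rwa [neg_pow, hcq.mul_pow, hz, zero_mul, mul_zero, mul_zero] at this

variable {n : ℕ}

theorem isu_zero : IsStrictUpper (0 : Matrix (Fin n) (Fin n) ℚ) := fun i j _ => by simp

theorem IsStrictUpper.add {X Y : Matrix (Fin n) (Fin n) ℚ} (hX : IsStrictUpper X)
    (hY : IsStrictUpper Y) : IsStrictUpper (X + Y) := fun i j h => by
  simp [hX i j h, hY i j h]

theorem IsStrictUpper.smul {X : Matrix (Fin n) (Fin n) ℚ} (hX : IsStrictUpper X)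
    (q : ℚ) : IsStrictUpper (q • X) := fun i j h => by
  simp [hX i j h]

theorem IsStrictUpper.neg {X : Matrix (Fin n) (Fin n) ℚ} (hX : IsStrictUpper X)
     : IsStrictUpper (-X) := fun i j h => by
  simp [hX i j h]

theorem IsStrictUpper.mul {X Y : Matrix (Fin n) (Fin n) ℚ} (hX : IsStrictUpper X)
    (hY : IsStrictUpper Y) : IsStrictUpper (X * Y) := fun i j h => by
  rw [Matrix.mul_apply]
  refine Finset.sum_eq_zero fun k _ => ?_
  by_cases hk : k ≤ i
  · rw [hX i k hk, zero_mul]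
  · rw [hY k j (by omega), mul_zero]

theorem IsStrictUpper.pow {X : Matrix (Fin n) (Fin n) ℚ} (hX : IsStrictUpper X) (k : ℕ) :
    IsStrictUpper (X ^ (k + 1)) := by
  induction k with
  | zero => simpa using hX
  | succ k ih => rw [pow_succ]; exact ih.mul hX

theorem isu_sum {ι : Type*} (s : Finset ι) (f : ι → Matrix (Fin n) (Fin n) ℚ)
    (h : ∀ i ∈ s, IsStrictUpper (f i)) : IsStrictUpper (∑ i ∈ s, f i) := by
  classical
  induction s using Finset.induction_on with
  | empty => simpa using isu_zero
  | insert a s ha ih =>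
    rw [Finset.sum_insert ha]
    exact (h a (by simp)).add (ih fun i hi => h i (by simp [hi]))

theorem IsStrictUpper.mcomm {X Y : Matrix (Fin n) (Fin n) ℚ} (hX : IsStrictUpper X)
    (hY : IsStrictUpper Y) : IsStrictUpper (mcomm X Y) := by
  rw [_root_.mcomm, sub_eq_add_neg]; exact (hX.mul hY).add (hY.mul hX).neg

theorem IsStrictUpper.pow_n {X : Matrix (Fin n) (Fin n) ℚ} (hX : IsStrictUpper X) :
    X ^ n = 0 := by
  have key : ∀ k : ℕ, ∀ i j : Fin n, (j : ℕ) < i + k → (X ^ k) i j = 0 := by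
    intro k
    induction k with
    | zero =>
      intro i j h
      rw [pow_zero, Matrix.one_apply_ne]
      intro h'; subst h'; omega
    | succ k ih =>
      intro i j h
      rw [pow_succ, Matrix.mul_apply]
      refine Finset.sum_eq_zero fun l _ => ?_
      by_cases hl : (l : ℕ) < i + k
      · rw [ih i l hl, zero_mul]
      · rw [hX l j (by rw [Fin.le_def]; omega), mul_zero]
  ext i j
  exact key n i j (by omega)

theorem IsStrictUpper.pow_n1 {X : Matrix (Fin n) (Fin n) ℚ} (hX : IsStrictUpper X) :
    X ^ (n + 1) = 0 := by rw [pow_succ, hX.pow_n, zero_mul]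

theorem isu_of_ut {A : Matrix (Fin n) (Fin n) ℚ} (h : IsUnitriangular A) :
    IsStrictUpper (A - 1) := by
  intro i j hij
  rcases hij.lt_or_eq with h' | h'
  · rw [Matrix.sub_apply, h.2 i j h', Matrix.one_apply_ne (by omega), sub_zero]
  · subst h'; simp [h.1 j]

theorem isu_mlog {A : Matrix (Fin n) (Fin n) ℚ} (h : IsStrictUpper (A - 1)) :
    IsStrictUpper (mlog A) := by
  apply isu_sum
  intro k hk
  rw [Finset.mem_Icc] at hk
  obtain ⟨k, rfl⟩ : ∃ k', k = k' + 1 := ⟨k - 1, by omega⟩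
  exact (h.pow k).smul _

theorem isu_mexp {X : Matrix (Fin n) (Fin n) ℚ} (h : IsStrictUpper X) :
    IsStrictUpper (mexp X - 1) := by
  rw [mexp, Finset.sum_range_succ']
  simp only [Nat.factorial_zero, Nat.cast_one, inv_one, pow_zero, one_smul, add_sub_cancel_right]
  exact isu_sum _ _ fun k _ => (h.pow k).smul _

theorem mexp_eq_exN (X : Matrix (Fin n) (Fin n) ℚ) : mexp X = exN (n + 1) X := rfl

theorem mexp_eq_exp {X : Matrix (Fin n) (Fin n) ℚ} (h : IsStrictUpper X) :
    mexp X = IsNilpotent.exp X := exN_eq h.pow_n1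

theorem mlog_eq_aeval (A : Matrix (Fin n) (Fin n) ℚ) : mlog A = aeval (A - 1) (lgPoly n) := by
  rw [mlog, lgPoly, map_sum]
  refine Finset.sum_congr rfl fun k _ => ?_
  rw [aeval_monomial, Algebra.smul_def]

theorem mexp_eq_aeval (X : Matrix (Fin n) (Fin n) ℚ) :
    mexp X = aeval X (exP (n + 1) (1 : ℚ)) := by
  rw [mexp, exP, map_sum]
  refine Finset.sum_congr rfl fun k _ => ?_
  rw [aeval_monomial, Algebra.smul_def]; simp

theorem mexp_mlog {A : Matrix (Fin n) (Fin n) ℚ} (h : IsStrictUpper (A - 1)) :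
    mexp (mlog A) = A := by
  rw [mexp_eq_aeval, mlog_eq_aeval, ← aeval_comp]
  obtain ⟨q, hq⟩ := exp_lg_aux n
  rw [sub_eq_iff_eq_add] at hq
  rw [hq]
  simp [h.pow_n1]

theorem mlog_mexp {X : Matrix (Fin n) (Fin n) ℚ} (h : IsStrictUpper X) :
    mlog (mexp X) = X := by
  have h1 := isu_mexp h
  have h2 := isu_mlog h1
  have h3 := mexp_mlog h1
  set Y := mlog (mexp X) with hY
  have hc : Commute X Y := by
    have a1 : Commute X (mexp X) := by
      apply Commute.sum_right
      intro k _
      exact ((Commute.refl X).pow_right k).smul_right _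
    rw [hY, mlog]
    apply Commute.sum_right
    intro k _
    exact ((a1.sub_right (Commute.one_right X)).pow_right k).smul_right _
  have hn : IsNilpotent Y := ⟨_, h2.pow_n⟩
  have h4 : IsNilpotent.exp (X + -Y) = 1 := by
    rw [IsNilpotent.exp_add_of_commute hc.neg_right ⟨_, h.pow_n⟩ hn.neg, ← mexp_eq_exp h, ← h3,
      mexp_eq_exp h2, IsNilpotent.exp_mul_exp_neg_self hn]
  have := exp_eq_one_imp (h.add h2.neg).pow_n h4
  rw [← sub_eq_add_neg, sub_eq_zero] at this
  exact this.symm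

theorem mlog_mul {A B : Matrix (Fin n) (Fin n) ℚ} (hA : IsStrictUpper (A - 1))
    (hB : IsStrictUpper (B - 1))
    (h1 : mcomm (mcomm (mlog A) (mlog B)) (mlog A) = 0)
    (h2 : mcomm (mcomm (mlog A) (mlog B)) (mlog B) = 0) :
    mlog (A * B) = mlog A + mlog B + (1 / 2 : ℚ) • mcomm (mlog A) (mlog B) := by
  have a := isu_mlog hA
  have b := isu_mlog hB
  have c := a.mcomm b
  have hall := (a.add b).add (c.smul (1 / 2))
  rw [← mlog_mexp hall]
  congr 1
  rw [mexp_eq_exN, ← bch_aux (c := mcomm (mlog A) (mlog B)) rfl (sub_eq_zero.mp h1) (sub_eq_zero.mp h2) a.pow_n1 b.pow_n1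
    (a.add b).pow_n1 (c.smul _).pow_n1 hall.pow_n1, ← mexp_eq_exN, ← mexp_eq_exN,
    mexp_mlog hA, mexp_mlog hB]

end MatPart
section WordPart

variable {n : ℕ}

local notation "𝕄" => Matrix (Fin n) (Fin n) ℚ

theorem mcomm_add_left (X Y Z : 𝕄) : mcomm (X + Y) Z = mcomm X Z + mcomm Y Z := by
  simp only [mcomm, add_mul, mul_add]; abel
theorem mcomm_add_right (X Y Z : 𝕄) : mcomm X (Y + Z) = mcomm X Y + mcomm X Z := by
  simp only [mcomm, add_mul, mul_add]; abel
theorem mcomm_smul_left (q : ℚ) (X Y : 𝕄) : mcomm (q • X) Y = q • mcomm X Y := by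
  simp only [mcomm, smul_mul_assoc, mul_smul_comm, smul_sub]
theorem mcomm_smul_right (q : ℚ) (X Y : 𝕄) : mcomm X (q • Y) = q • mcomm X Y := by
  simp only [mcomm, smul_mul_assoc, mul_smul_comm, smul_sub]
theorem mcomm_self (X : 𝕄) : mcomm X X = 0 := sub_self _
theorem mcomm_swap (X Y : 𝕄) : mcomm X Y = - mcomm Y X := by simp [mcomm]
theorem mcomm_zero_right (X : 𝕄) : mcomm X 0 = 0 := by simp [mcomm]
theorem mcomm_zero_left (X : 𝕄) : mcomm 0 X = 0 := by simp [mcomm]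

variable {k : ℕ}

/-- Sum of the letters of a word. -/
def wS (x : Fin k → 𝕄) : List (Fin k) → 𝕄
  | [] => 0
  | a :: w => x a + wS x w

/-- Sum of the commutators over ordered pairs of positions of a word. -/
def wD (x : Fin k → 𝕄) : List (Fin k) → 𝕄
  | [] => 0
  | a :: w => wD x w + mcomm (x a) (wS x w)

def wrep (w : List (Fin k)) : ℕ → List (Fin k)
  | 0 => []
  | t + 1 => w ++ wrep w t

theorem wS_append (x : Fin k → 𝕄) (u v : List (Fin k)) : wS x (u ++ v) = wS x u + wS x v := by
  induction u with
  | nil => simp [wS]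
  | cons a u ih => simp [wS, ih, add_assoc]

theorem wD_append (x : Fin k → 𝕄) (u v : List (Fin k)) :
    wD x (u ++ v) = wD x u + wD x v + mcomm (wS x u) (wS x v) := by
  induction u with
  | nil => simp [wS, wD, mcomm_zero_left]
  | cons a u ih =>
    simp only [List.cons_append, wD, wS, ih, wS_append, mcomm_add_left, mcomm_add_right]; abel

theorem wS_reverse (x : Fin k → 𝕄) (u : List (Fin k)) : wS x u.reverse = wS x u := by
  induction u with
  | nil => simp
  | cons a u ih => simp [wS_append, ih, wS, add_comm]

theorem wD_reverse (x : Fin k → 𝕄) (u : List (Fin k)) : wD x u.reverse = - wD x u := by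
  induction u with
  | nil => simp [wD]
  | cons a u ih =>
    rw [List.reverse_cons, wD_append, ih, wS_reverse]
    simp only [wD, wS, mcomm_zero_right, add_zero]
    rw [mcomm_swap]; abel

theorem wS_wrep (x : Fin k → 𝕄) (w : List (Fin k)) (t : ℕ) :
    wS x (wrep w t) = (t : ℚ) • wS x w := by
  induction t with
  | zero => simp [wrep, wS]
  | succ t ih => rw [wrep, wS_append, ih]; push_cast; module

theorem wD_wrep (x : Fin k → 𝕄) (w : List (Fin k)) (t : ℕ) :
    wD x (wrep w t) = (t : ℚ) • wD x w := by
  induction t with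
  | zero => simp [wrep, wD]
  | succ t ih =>
    rw [wrep, wD_append, ih, wS_wrep, mcomm_smul_right, mcomm_self]; push_cast; module

theorem wrep_ne {w : List (Fin k)} (hw : w ≠ []) {t : ℕ} (ht : 0 < t) : wrep w t ≠ [] := by
  cases t with
  | zero => omega
  | succ t => simp [wrep, hw]

theorem wS_single (x : Fin k → 𝕄) (a : Fin k) : wS x [a] = x a := by simp [wS]
theorem wD_single (x : Fin k → 𝕄) (a : Fin k) : wD x [a] = 0 := by
  simp [wD, wS, mcomm_zero_right]

/-- `E + z` becomes the log of a word after scaling. -/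
def Good (x : Fin k → 𝕄) (E z : 𝕄) : Prop :=
  ∃ (t : ℕ) (w : List (Fin k)), 0 < t ∧ w ≠ [] ∧ wS x w = (t : ℚ) • E ∧
    wD x w = (2 * t : ℚ) • z

theorem good_nat {x : Fin k → 𝕄} {E z₁ z₂ : 𝕄} (h₁ : Good x E z₁) (h₂ : Good x E z₂)
    (a b : ℕ) (hab : 0 < a + b) :
    Good x E (((a : ℚ) / (a + b)) • z₁ + ((b : ℚ) / (a + b)) • z₂) := by
  obtain ⟨t₁, w₁, ht₁, hw₁, hS₁, hD₁⟩ := h₁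
  obtain ⟨t₂, w₂, ht₂, hw₂, hS₂, hD₂⟩ := h₂
  refine ⟨(a + b) * t₁ * t₂, wrep w₁ (a * t₂) ++ wrep w₂ (b * t₁), by positivity, ?_, ?_, ?_⟩
  · rcases Nat.eq_zero_or_pos a with h | h
    · have : wrep w₂ (b * t₁) ≠ [] := wrep_ne hw₂ (Nat.mul_pos (by omega) ht₁)
      simp [this]
    · have : wrep w₁ (a * t₂) ≠ [] := wrep_ne hw₁ (Nat.mul_pos h ht₂)
      simp [this]
  · rw [wS_append, wS_wrep, wS_wrep, hS₁, hS₂]; push_cast; module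
  · rw [wD_append, wD_wrep, wD_wrep, wS_wrep, wS_wrep, hS₁, hS₂, hD₁, hD₂]
    simp only [mcomm_smul_left, mcomm_smul_right, mcomm_self, smul_zero, add_zero]
    have : ((a : ℚ) + b) ≠ 0 := by exact_mod_cast hab.ne'
    push_cast
    match_scalars <;> field_simp

theorem good_convex {x : Fin k → 𝕄} {E z₁ z₂ : 𝕄} (h₁ : Good x E z₁) (h₂ : Good x E z₂)
    {p q : ℚ} (hp : 0 ≤ p) (hq : 0 ≤ q) (hpq : p + q = 1) : Good x E (p • z₁ + q • z₂) := by
  have key := good_nat h₁ h₂ (p.num.toNat * q.den) (q.num.toNat * p.den)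
  have e1 : ((p.num.toNat : ℕ) : ℚ) = p * p.den := by
    rw [Rat.mul_den_eq_num]
    have := Int.toNat_of_nonneg (Rat.num_nonneg.mpr hp)
    exact_mod_cast congrArg (fun z : ℤ => (z : ℚ)) this
  have e2 : ((q.num.toNat : ℕ) : ℚ) = q * q.den := by
    rw [Rat.mul_den_eq_num]
    have := Int.toNat_of_nonneg (Rat.num_nonneg.mpr hq)
    exact_mod_cast congrArg (fun z : ℤ => (z : ℚ)) this
  have hpd : (p.den : ℚ) ≠ 0 := by exact_mod_cast p.den_nz
  have hqd : (q.den : ℚ) ≠ 0 := by exact_mod_cast q.den_nz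
  have e3 : p * p.den * q.den + q * q.den * p.den = p.den * q.den := by
    calc _ = (p + q) * (p.den * q.den) := by ring
      _ = _ := by rw [hpq, one_mul]
  have hpos : 0 < p.num.toNat * q.den + q.num.toNat * p.den := by
    have : (0 : ℚ) < ((p.num.toNat * q.den + q.num.toNat * p.den : ℕ) : ℚ) := by
      push_cast
      rw [e1, e2, e3]
      have := p.den_pos; have := q.den_pos; positivity
    exact_mod_cast this
  have key := key hpos
  push_cast at key
  rw [e1, e2, e3] at key
  convert key using 3
  · field_simp
  · field_simp

/-- All rational multiples are good. -/
def Line (x : Fin k → 𝕄) (E v : 𝕄) : Prop := ∀ r : ℚ, Good x E (r • v)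

theorem line_add {x : Fin k → 𝕄} {E v w : 𝕄} (hv : Line x E v) (hw : Line x E w) :
    Line x E (v + w) := by
  intro r
  have := good_convex (hv (2 * r)) (hw (2 * r)) (p := 1 / 2) (q := 1 / 2)
    (by norm_num) (by norm_num) (by norm_num)
  convert this using 1
  module

theorem line_smul {x : Fin k → 𝕄} {E v : 𝕄} (hv : Line x E v) (q : ℚ) :
    Line x E (q • v) := by
  intro r; rw [smul_smul]; exact hv _

theorem exists_word (x : Fin k → 𝕄) (l : Fin k → ℕ) :
    ∃ u, wS x u = ∑ i, (l i : ℚ) • x i ∧ ∀ i, 0 < l i → i ∈ u := by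
  have : ∀ s : Finset (Fin k), ∃ u, wS x u = ∑ i ∈ s, (l i : ℚ) • x i ∧
      ∀ i ∈ s, 0 < l i → i ∈ u := by
    intro s
    induction s using Finset.induction_on with
    | empty => exact ⟨[], by simp [wS], by simp⟩
    | insert a s ha ih =>
      obtain ⟨u, hu, hm⟩ := ih
      refine ⟨wrep [a] (l a) ++ u, ?_, ?_⟩
      · rw [wS_append, wS_wrep, wS_single, hu, Finset.sum_insert ha]
      · intro i hi hl
        rw [Finset.mem_insert] at hi
        rw [List.mem_append]
        rcases hi with rfl | hi
        · left
          obtain ⟨t, ht⟩ : ∃ t, l i = t + 1 := ⟨l i - 1, by omega⟩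
          rw [ht]; simp [wrep]
        · exact Or.inr (hm i hi hl)
  obtain ⟨u, h1, h2⟩ := this Finset.univ
  exact ⟨u, h1, fun i => h2 i (Finset.mem_univ i)⟩

theorem good_zero (x : Fin k → 𝕄) (l : Fin k → ℕ) (hl : l ≠ 0) :
    Good x (∑ i, (l i : ℚ) • x i) 0 := by
  obtain ⟨u, hu, hm⟩ := exists_word x l
  obtain ⟨i, hi⟩ := Function.ne_iff.mp hl
  refine ⟨2, u ++ u.reverse, by norm_num, ?_, ?_, ?_⟩
  · have := List.ne_nil_of_mem (hm i (Nat.pos_of_ne_zero hi))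
    simp [this]
  · rw [wS_append, wS_reverse, hu]; push_cast; module
  · rw [wD_append, wS_reverse, wD_reverse, mcomm_self]; simp

theorem good_pair (x : Fin k → 𝕄) (l : Fin k → ℕ) {a b : Fin k} (hab : a ≠ b) (ha : 0 < l a)
    (s : ℕ) (hs : 0 < s) :
    Good x (∑ i, (l i : ℚ) • x i) ((s * l a * l b / 2 : ℚ) • mcomm (x a) (x b)) := by
  obtain ⟨u, hu, -⟩ := exists_word x (fun i => if i = a ∨ i = b then 0 else s * l i)
  set m := wrep [a] (s * l a) ++ wrep [b] (s * l b) with hm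
  have hSm : wS x m = (s * l a : ℚ) • x a + (s * l b : ℚ) • x b := by
    rw [hm, wS_append, wS_wrep, wS_wrep, wS_single, wS_single]; push_cast; rfl
  have hDm : wD x m = (s * l a * (s * l b) : ℚ) • mcomm (x a) (x b) := by
    rw [hm, wD_append, wD_wrep, wD_wrep, wS_wrep, wS_wrep, wS_single, wS_single, wD_single,
      wD_single, mcomm_smul_left, mcomm_smul_right]; push_cast; module
  have hE : wS x u + wS x m = (s : ℚ) • ∑ i, (l i : ℚ) • x i := by
    have e : ∀ i, (s : ℚ) • (l i : ℚ) • x i =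
        (((if i = a ∨ i = b then 0 else s * l i : ℕ) : ℚ) • x i
          + (if i = a then (s * l a : ℚ) • x a else 0)) +
          (if i = b then (s * l b : ℚ) • x b else 0) := by
      intro i
      by_cases h1 : i = a
      · subst h1; simp [hab, smul_smul]
      · by_cases h2 : i = b
        · subst h2; simp [h1, smul_smul]
        · simp [h1, h2, smul_smul]
    rw [Finset.smul_sum, Finset.sum_congr rfl (fun i _ => e i), Finset.sum_add_distrib,
      Finset.sum_add_distrib, hu, hSm]
    simp [add_assoc]
  have hmne : m ≠ [] := by
    have : wrep [a] (s * l a) ≠ [] := wrep_ne (by simp) (by positivity)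
    simp [hm, this]
  clear_value m
  refine ⟨2 * s, (u ++ m) ++ (m ++ u.reverse), by positivity, ?_, ?_, ?_⟩
  · simp [hmne]
  · rw [wS_append, wS_append, wS_append, wS_reverse, add_comm (wS x m), hE]; push_cast; module
  · rw [wD_append, wD_append, wD_append, wS_append, wS_append, wS_reverse, wD_reverse,
      add_comm (wS x m), mcomm_self, mcomm_swap (wS x m), hDm]; push_cast; module

theorem line_pair (x : Fin k → 𝕄) (l : Fin k → ℕ) {a b : Fin k} (hab : a ≠ b) (ha : 0 < l a)
    (hb : 0 < l b) : Line x (∑ i, (l i : ℚ) • x i) (mcomm (x a) (x b)) := by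
  intro r
  obtain ⟨s, hs⟩ := exists_nat_gt (2 * |r| + 1)
  have hs0 : 0 < s := by
    have : (0 : ℚ) < s := lt_of_le_of_lt (by positivity) hs
    exact_mod_cast this
  have g1 := good_pair x l hab ha s hs0
  have g2 := good_pair x l hab.symm hb s hs0
  set y : ℚ := s * l a * l b / 2 with hy
  have hy' : (s * l b * l a / 2 : ℚ) = y := by rw [hy]; ring
  rw [hy', mcomm_swap] at g2
  have ha1 : (1 : ℚ) ≤ l a := by exact_mod_cast ha
  have hb1 : (1 : ℚ) ≤ l b := by exact_mod_cast hb
  have hsy : (s : ℚ) / 2 ≤ y := by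
    rw [hy]
    have : (1 : ℚ) ≤ l a * l b := one_le_mul_of_one_le_of_one_le ha1 hb1
    have h0 : (0 : ℚ) ≤ s := by positivity
    nlinarith
  have hry : |r| < y := by linarith
  have hy0 : 0 < y := lt_of_le_of_lt (abs_nonneg r) hry
  have hr := abs_lt.mp hry
  have := good_convex g1 g2 (p := (1 + r / y) / 2) (q := (1 - r / y) / 2)
    (by
      have : -1 ≤ r / y := by rw [le_div_iff₀ hy0]; linarith
      linarith)
    (by
      have : r / y ≤ 1 := by rw [div_le_iff₀ hy0]; linarith
      linarith) (by ring)
  convert this using 1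
  match_scalars
  field_simp
  ring

theorem good_main (x : Fin k → 𝕄) (l : Fin k → ℕ) (hl : l ≠ 0) (c : Fin k → Fin k → ℚ) :
    Good x (∑ i, (l i : ℚ) • x i) (∑ i : Fin k, ∑ j ∈ Finset.Ioi i,
            (if 0 < l i ∧ 0 < l j then c i j else 0) • mcomm (x i) (x j)) := by
  set E := ∑ i, (l i : ℚ) • x i with hE
  have h0 : Line x E 0 := fun r => by rw [smul_zero]; exact good_zero x l hl
  have : Line x E (∑ i : Fin k, ∑ j ∈ Finset.Ioi i,
            (if 0 < l i ∧ 0 < l j then c i j else 0) • mcomm (x i) (x j)) := by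
    refine Finset.sum_induction _ (Line x E) (fun _ _ => line_add) h0 fun i _ => ?_
    refine Finset.sum_induction _ (Line x E) (fun _ _ => line_add) h0 fun j hj => ?_
    rw [Finset.mem_Ioi] at hj
    split_ifs with h
    · exact line_smul (line_pair x l hj.ne h.1 h.2) _
    · rw [zero_smul]; exact h0
  simpa using this 1

/-- Combinations of commutators of letters in the support. -/
def InQ (x : Fin k → 𝕄) (l : Fin k → ℕ) (z : 𝕄) : Prop :=
  ∃ c : Fin k → Fin k → ℚ, z = ∑ i : Fin k, ∑ j ∈ Finset.Ioi i,
            (if 0 < l i ∧ 0 < l j then c i j else 0) • mcomm (x i) (x j)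

theorem inQ_zero (x : Fin k → 𝕄) (l : Fin k → ℕ) : InQ x l 0 := ⟨0, by simp⟩

theorem inQ_add {x : Fin k → 𝕄} {l : Fin k → ℕ} {y z : 𝕄} (hy : InQ x l y) (hz : InQ x l z) :
    InQ x l (y + z) := by
  obtain ⟨c, rfl⟩ := hy
  obtain ⟨d, rfl⟩ := hz
  refine ⟨c + d, ?_⟩
  simp only [← Finset.sum_add_distrib, ← add_smul]
  refine Finset.sum_congr rfl fun i _ => Finset.sum_congr rfl fun j _ => ?_
  split_ifs <;> simp

theorem inQ_smul {x : Fin k → 𝕄} {l : Fin k → ℕ} {y : 𝕄} (hy : InQ x l y) (q : ℚ) :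
    InQ x l (q • y) := by
  obtain ⟨c, rfl⟩ := hy
  refine ⟨fun i j => q * c i j, ?_⟩
  simp only [Finset.smul_sum, smul_smul]
  refine Finset.sum_congr rfl fun i _ => Finset.sum_congr rfl fun j _ => ?_
  split_ifs <;> simp

theorem inQ_lt {x : Fin k → 𝕄} {l : Fin k → ℕ} {a b : Fin k} (hab : a < b) (ha : 0 < l a)
    (hb : 0 < l b) : InQ x l (mcomm (x a) (x b)) := by
  refine ⟨fun i j => if i = a ∧ j = b then 1 else 0, ?_⟩
  rw [Finset.sum_eq_single a, Finset.sum_eq_single b]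
  · simp [ha, hb]
  · intro j _ hj; simp [hj]
  · intro h; exact absurd (Finset.mem_Ioi.mpr hab) h
  · intro i _ hi; refine Finset.sum_eq_zero fun j _ => ?_; simp [hi]
  · simp

theorem inQ_pair {x : Fin k → 𝕄} {l : Fin k → ℕ} {a b : Fin k} (ha : 0 < l a)
    (hb : 0 < l b) : InQ x l (mcomm (x a) (x b)) := by
  rcases lt_trichotomy a b with h | h | h
  · exact inQ_lt h ha hb
  · subst h; rw [mcomm_self]; exact inQ_zero x l
  · rw [mcomm_swap, ← neg_one_smul ℚ]; exact inQ_smul (inQ_lt h hb ha) _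

theorem inQ_letter {x : Fin k → 𝕄} {l : Fin k → ℕ} {a : Fin k} (ha : 0 < l a) (w : List (Fin k))
    (hw : ∀ i ∈ w, 0 < l i) : InQ x l (mcomm (x a) (wS x w)) := by
  induction w with
  | nil => rw [wS, mcomm_zero_right]; exact inQ_zero x l
  | cons b w ih =>
    rw [wS, mcomm_add_right]
    exact inQ_add (inQ_pair ha (hw b (by simp))) (ih fun i hi => hw i (by simp [hi]))

theorem inQ_wD {x : Fin k → 𝕄} {l : Fin k → ℕ} (w : List (Fin k))
    (hw : ∀ i ∈ w, 0 < l i) : InQ x l (wD x w) := by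
  induction w with
  | nil => exact inQ_zero x l
  | cons b w ih =>
    have hw' : ∀ i ∈ w, 0 < l i := fun i hi => hw i (by simp [hi])
    exact inQ_add (ih hw') (inQ_letter (hw b (by simp)) w hw')

theorem wS_count (x : Fin k → 𝕄) (w : List (Fin k)) :
    wS x w = ∑ i, (w.count i : ℚ) • x i := by
  induction w with
  | nil => simp [wS]
  | cons a w ih =>
    rw [wS, ih]
    have : ∀ i, (((a :: w).count i : ℕ) : ℚ) • x i
        = (if a = i then x a else 0) + (w.count i : ℚ) • x i := by
      intro i
      rw [List.count_cons]
      by_cases h : a = i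
      · subst h; simp [add_smul, add_comm]
      · simp [h]
    rw [Finset.sum_congr rfl fun i _ => this i, Finset.sum_add_distrib]
    simp

theorem mlog_one : mlog (1 : 𝕄) = 0 := by
  rw [mlog]
  refine Finset.sum_eq_zero fun j hj => ?_
  rw [Finset.mem_Icc] at hj
  rw [sub_self, zero_pow (by omega), smul_zero]

theorem word_log (G : Set 𝕄)
    (hUT : ∀ A ∈ G, IsUnitriangular A)
    (hone : (1 : 𝕄) ∈ G)
    (hmul : ∀ A ∈ G, ∀ B ∈ G, A * B ∈ G)
    (h2step : ∀ X ∈ G, ∀ Y ∈ G, ∀ Z ∈ G, mcomm (mcomm (mlog X) (mlog Y)) (mlog Z) = 0)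
    (A : Fin k → 𝕄) (hA : ∀ i, A i ∈ G) (w : List (Fin k)) :
    (w.map A).prod ∈ G ∧ mlog (w.map A).prod =
      wS (fun i => mlog (A i)) w + (1 / 2 : ℚ) • wD (fun i => mlog (A i)) w := by
  set x : Fin k → 𝕄 := fun i => mlog (A i) with hx
  have c1 : ∀ w : List (Fin k), ∀ X ∈ G, ∀ Z ∈ G, mcomm (mcomm (mlog X) (wS x w)) (mlog Z) = 0 := by
    intro w X hX Z hZ
    induction w with
    | nil => rw [wS, mcomm_zero_right, mcomm_zero_left]
    | cons a w ih =>
      rw [wS, mcomm_add_right, mcomm_add_left, ih, h2step X hX _ (hA a) Z hZ, add_zero]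
  have c2 : ∀ w : List (Fin k), ∀ Z ∈ G, mcomm (wD x w) (mlog Z) = 0 := by
    intro w Z hZ
    induction w with
    | nil => rw [wD, mcomm_zero_left]
    | cons a w ih =>
      rw [wD, mcomm_add_left, ih, c1 w _ (hA a) Z hZ, add_zero]
  induction w with
  | nil => exact ⟨by simpa using hone, by simp [wS, wD, mlog_one]⟩
  | cons a w ih =>
    obtain ⟨hP, hL⟩ := ih
    rw [List.map_cons, List.prod_cons]
    refine ⟨hmul _ (hA a) _ hP, ?_⟩
    rw [mlog_mul (isu_of_ut (hUT _ (hA a))) (isu_of_ut (hUT _ hP))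
      (h2step _ (hA a) _ hP _ (hA a)) (h2step _ (hA a) _ hP _ hP), hL, mcomm_add_right,
      mcomm_smul_right, mcomm_swap _ (wD x w), c2 w _ (hA a), wS, wD]
    module

end WordPart
/-- Proposition 5: reduction of Intersection Emptiness to linear algebra.
⟨𝒢_1⟩ ∩ ⋯ ∩ ⟨𝒢_M⟩ ≠ ∅ iff there are non-zero vectors ℓ_m ∈ ℤ_{≥0}^{K_m} and
rationals c_{mij} (for i < j in supp ℓ_m) making the M expressions
Σ_j ℓ_{mj} log A_{mj} + Σ_{i<j ∈ supp ℓ_m} c_{mij} [log A_{mi}, log A_{mj}] all equal. -/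
theorem stmt14 (n M : ℕ) (G : Set (Matrix (Fin n) (Fin n) ℚ))
    (hUT : ∀ A ∈ G, IsUnitriangular A)
    (hone : (1 : Matrix (Fin n) (Fin n) ℚ) ∈ G)
    (hmul : ∀ A ∈ G, ∀ B ∈ G, A * B ∈ G)
    (hinv : ∀ A ∈ G, ∃ B ∈ G, A * B = 1 ∧ B * A = 1)
    (h2step : ∀ X ∈ G, ∀ Y ∈ G, ∀ Z ∈ G, mcomm (mcomm (mlog X) (mlog Y)) (mlog Z) = 0)
    (K : Fin M → ℕ) (A : (m : Fin M) → Fin (K m) → Matrix (Fin n) (Fin n) ℚ)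
    (hA : ∀ m i, A m i ∈ G) :
    (∃ g : Matrix (Fin n) (Fin n) ℚ, ∀ m : Fin M,
        ∃ w : List (Fin (K m)), w ≠ [] ∧ (w.map (A m)).prod = g) ↔
    (∃ (ℓ : (m : Fin M) → Fin (K m) → ℕ) (c : (m : Fin M) → Fin (K m) → Fin (K m) → ℚ)
        (L : Matrix (Fin n) (Fin n) ℚ),
      (∀ m, ℓ m ≠ 0) ∧
      ∀ m : Fin M,
        (∑ j : Fin (K m), (ℓ m j : ℚ) • mlog (A m j)) +
          (∑ i : Fin (K m), ∑ j ∈ Finset.Ioi i,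
            (if 0 < ℓ m i ∧ 0 < ℓ m j then c m i j else 0) •
              mcomm (mlog (A m i)) (mlog (A m j))) = L) := by
  constructor
  · rintro ⟨g, hg⟩
    choose w hw hp using hg
    have hQ : ∀ m, InQ (fun i => mlog (A m i)) (fun i => (w m).count i)
        ((1 / 2 : ℚ) • wD (fun i => mlog (A m i)) (w m)) := fun m =>
      inQ_smul (inQ_wD (w m) fun i hi => List.count_pos_iff.mpr hi) _
    choose c hc using hQ
    refine ⟨fun m i => (w m).count i, c, mlog g, ?_, ?_⟩
    · intro m h
      obtain ⟨a, ha⟩ := List.exists_mem_of_ne_nil _ (hw m)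
      have h1 : (w m).count a = 0 := congrFun h a
      exact (List.count_pos_iff.mpr ha).ne' h1
    · intro m
      have h1 := (word_log G hUT hone hmul h2step (A m) (hA m) (w m)).2
      rw [hp m, hc m, wS_count] at h1
      exact h1.symm
  · rintro ⟨ℓ, c, L, hℓ, hL⟩
    have hG := fun m => good_main (fun i => mlog (A m i)) (ℓ m) (hℓ m) (c m)
    choose t w ht hw hS hD using hG
    refine ⟨mexp (((∏ m, t m : ℕ) : ℚ) • L), fun m => ?_⟩
    obtain ⟨q, hq⟩ := Finset.dvd_prod_of_mem t (Finset.mem_univ m)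
    have hq0 : 0 < q := by
      have : 0 < ∏ m, t m := Finset.prod_pos fun m _ => ht m
      rw [hq] at this
      exact Nat.pos_of_mul_pos_left this
    refine ⟨wrep (w m) q, wrep_ne (hw m) hq0, ?_⟩
    have h1 := word_log G hUT hone hmul h2step (A m) (hA m) (wrep (w m) q)
    rw [← mexp_mlog (isu_of_ut (hUT _ h1.1)), h1.2, wS_wrep, wD_wrep, hS m, hD m, hq, ← hL m]
    congr 1
    push_cast
    module
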